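/- With β(t) = G(X #_t μ) the Cartan barycentric trajectory, the following are equivalent: (i) β'(0) = 0; (ii) X = G(μ); (iii) X = G(X #_t μ) for some (equivalently all) t ≠ 0. -/

import Mathlib

open MeasureTheory
open scoped ComplexOrder

abbrev Mat (m : ℕ) := Matrix (Fin m) (Fin m) ℂ

noncomputable instance {m : ℕ} : MeasurableSpace (Mat m) := borel _
instance {m : ℕ} : BorelSpace (Mat m) := ⟨rfl⟩

/-- Functional calculus on Hermitian matrices (junk value `A` otherwise). -/
noncomputable def matFun {m : ℕ} (f : ℝ → ℝ) (A : Mat m) : Mat m :=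
  if h : A.IsHermitian then
    (h.eigenvectorUnitary : Mat m) *
      Matrix.diagonal (fun i => (f (h.eigenvalues i) : ℂ)) *
      star (h.eigenvectorUnitary : Mat m)
  else A

/-- Real power `A^t` of a positive definite matrix, via the spectral decomposition. -/
noncomputable def mpow {m : ℕ} (A : Mat m) (t : ℝ) : Mat m := matFun (fun x => x ^ t) A

/-- Logarithm of a positive definite matrix, via the spectral decomposition. -/
noncomputable def mlog {m : ℕ} (A : Mat m) : Mat m := matFun Real.log A

/-- The operator norm of a matrix (acting on the Euclidean space). -/
noncomputable def opN {m : ℕ} (A : Mat m) : ℝ :=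
  ‖(Matrix.toEuclideanCLM (𝕜 := ℂ) A : EuclideanSpace ℂ (Fin m) →L[ℂ] EuclideanSpace ℂ (Fin m))‖

/-- The Frobenius (Hilbert-Schmidt) norm of a matrix. -/
noncomputable def fnorm {m : ℕ} (A : Mat m) : ℝ :=
  Real.sqrt (∑ i, ∑ j, ‖A i j‖ ^ 2)

/-- The Riemannian trace metric distance `d(A,B) = ‖log (A^{-1/2} B A^{-1/2})‖₂`. -/
noncomputable def rdist {m : ℕ} (A B : Mat m) : ℝ :=
  fnorm (mlog (mpow A (-(1/2 : ℝ)) * B * mpow A (-(1/2 : ℝ))))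

/-- The `t`-weighted geometric mean `X #_t A = X^{1/2} (X^{-1/2} A X^{-1/2})^t X^{1/2}`. -/
noncomputable def geom {m : ℕ} (X : Mat m) (t : ℝ) (A : Mat m) : Mat m :=
  mpow X (1/2 : ℝ) * mpow (mpow X (-(1/2 : ℝ)) * A * mpow X (-(1/2 : ℝ))) t * mpow X (1/2 : ℝ)

/-- Finite first moment for a measure on positive definite matrices. -/
def HasFFM {m : ℕ} (μ : Measure (Mat m)) : Prop :=
  ∃ Y : Mat m, Y.PosDef ∧ Integrable (fun A => rdist A Y) μ

/-- Couplings of two probability measures. -/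
def couplings {m : ℕ} (μ ν : Measure (Mat m)) : Set (Measure (Mat m × Mat m)) :=
  {π | IsProbabilityMeasure π ∧ π.map Prod.fst = μ ∧ π.map Prod.snd = ν}

/-- The 1-Wasserstein distance with respect to the Riemannian trace metric. -/
noncomputable def W1 {m : ℕ} (μ ν : Measure (Mat m)) : ℝ :=
  sInf ((fun π : Measure (Mat m × Mat m) => ∫ p, rdist p.1 p.2 ∂π) '' couplings μ ν)

attribute [local instance] Matrix.frobeniusNormedAddCommGroup Matrix.frobeniusNormedSpace

/-- The left-hand side of the Karcher equation `∫ log (X^{-1/2} A X^{-1/2}) dμ(A)`. -/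
noncomputable def karcherLHS {m : ℕ} (X : Mat m) (μ : Measure (Mat m)) : Mat m :=
  ∫ A, mlog (mpow X (-(1/2 : ℝ)) * A * mpow X (-(1/2 : ℝ))) ∂μ

/-- `G` is the Cartan barycenter map: for every probability measure supported on the
positive definite matrices with finite first moment, `G μ` is the (unique) positive
definite solution of the Karcher equation. -/
def IsCartanBary {m : ℕ} (G : Measure (Mat m) → Mat m) : Prop :=
  ∀ μ : Measure (Mat m), IsProbabilityMeasure μ → (∀ᵐ A ∂μ, A.PosDef) → HasFFM μ →
    (G μ).PosDef ∧ karcherLHS (G μ) μ = 0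

section SpectralCalculus

open Matrix

variable {m : ℕ}

/-- The diagonal complex matrix with prescribed real diagonal. -/
noncomputable def realDiagonal (d : Fin m → ℝ) : Mat m := diagonal (fun i => (d i : ℂ))

theorem realDiagonal_mul (d e : Fin m → ℝ) :
    realDiagonal d * realDiagonal e = realDiagonal (d * e) := by
  simp [realDiagonal, diagonal_mul_diagonal]

theorem realDiagonal_one : realDiagonal (1 : Fin m → ℝ) = 1 := by
  simp [realDiagonal]

theorem isHermitian_realDiagonal (d : Fin m → ℝ) : (realDiagonal d).IsHermitian := by
  rw [realDiagonal, isHermitian_diagonal_iff]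
  intro i
  simp [isSelfAdjoint_iff]

theorem exists_realDiagonal {A : Mat m} (hA : A.IsHermitian) :
    ∃ U ∈ unitaryGroup (Fin m) ℂ, ∃ d : Fin m → ℝ, A = U * realDiagonal d * star U := by
  refine ⟨hA.eigenvectorUnitary.1, hA.eigenvectorUnitary.2, hA.eigenvalues, ?_⟩
  conv_lhs => rw [hA.spectral_theorem, Unitary.conjStarAlgAut_apply]
  rfl

theorem isHermitian_conj (U : Mat m) (d : Fin m → ℝ) :
    (U * realDiagonal d * star U).IsHermitian :=
  isHermitian_mul_mul_conjTranspose U (isHermitian_realDiagonal d)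

theorem conj_realDiagonal_mul {U : Mat m} (hU : U ∈ unitaryGroup (Fin m) ℂ) (d e : Fin m → ℝ) :
    (U * realDiagonal d * star U) * (U * realDiagonal e * star U)
      = U * realDiagonal (d * e) * star U := by
  have h := mem_unitaryGroup_iff'.1 hU
  calc _ = U * realDiagonal d * (star U * U) * realDiagonal e * star U := by
        simp only [Matrix.mul_assoc]
    _ = _ := by rw [h, Matrix.mul_one, Matrix.mul_assoc U, realDiagonal_mul]

theorem star_mul_conj_mul {U V : Mat m} (hU : U ∈ unitaryGroup (Fin m) ℂ) (d : Fin m → ℝ)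
    (i j : Fin m) :
    (star V * (U * realDiagonal d * star U) * U) i j = (star V * U) i j * d j := by
  have h := mem_unitaryGroup_iff'.1 hU
  have : star V * (U * realDiagonal d * star U) * U = (star V * U) * realDiagonal d := by
    calc _ = star V * U * realDiagonal d * (star U * U) := by simp only [Matrix.mul_assoc]
      _ = _ := by rw [h, Matrix.mul_one]
  rw [this, realDiagonal, mul_diagonal]

theorem star_mul_conj_mul' {U V : Mat m} (hV : V ∈ unitaryGroup (Fin m) ℂ) (d : Fin m → ℝ)
    (i j : Fin m) :
    (star V * (V * realDiagonal d * star V) * U) i j = d i * (star V * U) i j := by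
  have h := mem_unitaryGroup_iff'.1 hV
  have : star V * (V * realDiagonal d * star V) * U = realDiagonal d * (star V * U) := by
    calc _ = (star V * V) * realDiagonal d * (star V * U) := by simp only [Matrix.mul_assoc]
      _ = _ := by rw [h, Matrix.one_mul]
  rw [this, realDiagonal, diagonal_mul]

theorem matFun_conj {U : Mat m} (hU : U ∈ unitaryGroup (Fin m) ℂ) (d : Fin m → ℝ) (f : ℝ → ℝ) :
    matFun f (U * realDiagonal d * star U) = U * realDiagonal (fun i => f (d i)) * star U := by
  have hA := isHermitian_conj U d
  set V : Mat m := hA.eigenvectorUnitary.1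
  have hV : V ∈ unitaryGroup (Fin m) ℂ := hA.eigenvectorUnitary.2
  set e := hA.eigenvalues
  have h1 : U * realDiagonal d * star U = V * realDiagonal e * star V := by
    conv_lhs => rw [hA.spectral_theorem, Unitary.conjStarAlgAut_apply]
    rfl
  have h2 : matFun f (U * realDiagonal d * star U)
      = V * realDiagonal (fun i => f (e i)) * star V := by
    rw [matFun, dif_pos hA]; rfl
  rw [h2]
  have h3 : star V * (V * realDiagonal (fun i => f (e i)) * star V) * U
      = star V * (U * realDiagonal (fun i => f (d i)) * star U) * U := by
    ext i j
    rw [star_mul_conj_mul hU, star_mul_conj_mul' hV]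
    have h4 : (star V * U) i j * d j = e i * (star V * U) i j := by
      rw [← star_mul_conj_mul hU, ← star_mul_conj_mul' hV, h1]
    by_cases h5 : (star V * U) i j = 0
    · simp [h5]
    · have : d j = e i := by
        have : (d j : ℂ) = e i := mul_left_cancel₀ h5 (by rw [h4, mul_comm])
        exact_mod_cast this
      rw [this, mul_comm]
  have h6 := congrArg (fun M => V * M * star U) h3
  simpa only [Matrix.mul_assoc, mem_unitaryGroup_iff.1 hU, Matrix.mul_one,
    ← Matrix.mul_assoc V (star V), mem_unitaryGroup_iff.1 hV, Matrix.one_mul] using h6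

theorem posSemidef_conj_iff {U : Mat m} (hU : U ∈ unitaryGroup (Fin m) ℂ) (d : Fin m → ℝ) :
    (U * realDiagonal d * star U).PosSemidef ↔ ∀ i, 0 ≤ d i := by
  have hu : IsUnit U := IsUnit.of_mul_eq_one (star U) (mem_unitaryGroup_iff.1 hU)
  rw [Matrix.IsUnit.posSemidef_star_right_conjugate_iff hu, realDiagonal,
    posSemidef_diagonal_iff]
  simp

theorem posDef_conj_iff {U : Mat m} (hU : U ∈ unitaryGroup (Fin m) ℂ) (d : Fin m → ℝ) :
    (U * realDiagonal d * star U).PosDef ↔ ∀ i, 0 < d i := by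
  have hu : IsUnit U := IsUnit.of_mul_eq_one (star U) (mem_unitaryGroup_iff.1 hU)
  rw [Matrix.IsUnit.posDef_star_right_conjugate_iff hu, realDiagonal,
    posDef_diagonal_iff]
  simp

theorem exists_realDiagonal_pos {A : Mat m} (hA : A.PosDef) :
    ∃ U ∈ unitaryGroup (Fin m) ℂ, ∃ d : Fin m → ℝ,
      A = U * realDiagonal d * star U ∧ ∀ i, 0 < d i := by
  obtain ⟨U, hU, d, rfl⟩ := exists_realDiagonal hA.1
  exact ⟨U, hU, d, rfl, (posDef_conj_iff hU d).1 hA⟩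

theorem mpow_conj {U : Mat m} (hU : U ∈ unitaryGroup (Fin m) ℂ) (d : Fin m → ℝ) (t : ℝ) :
    mpow (U * realDiagonal d * star U) t = U * realDiagonal (fun i => d i ^ t) * star U :=
  matFun_conj hU d _

theorem mlog_conj {U : Mat m} (hU : U ∈ unitaryGroup (Fin m) ℂ) (d : Fin m → ℝ) :
    mlog (U * realDiagonal d * star U) = U * realDiagonal (fun i => Real.log (d i)) * star U :=
  matFun_conj hU d _

theorem posDef_mpow {A : Mat m} (hA : A.PosDef) (t : ℝ) : (mpow A t).PosDef := by
  obtain ⟨U, hU, d, rfl, hd⟩ := exists_realDiagonal_pos hA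
  rw [mpow_conj hU, posDef_conj_iff hU]
  exact fun i => Real.rpow_pos_of_pos (hd i) t

theorem star_mpow {A : Mat m} (hA : A.PosDef) (t : ℝ) : star (mpow A t) = mpow A t :=
  (posDef_mpow hA t).1

theorem mpow_mul_mpow {A : Mat m} (hA : A.PosDef) (s t : ℝ) :
    mpow A s * mpow A t = mpow A (s + t) := by
  obtain ⟨U, hU, d, rfl, hd⟩ := exists_realDiagonal_pos hA
  rw [mpow_conj hU, mpow_conj hU, mpow_conj hU, conj_realDiagonal_mul hU]
  congr 3
  ext i
  simp [Real.rpow_add (hd i)]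

theorem mpow_zero {A : Mat m} (hA : A.PosDef) : mpow A 0 = 1 := by
  obtain ⟨U, hU, d, rfl, hd⟩ := exists_realDiagonal_pos hA
  rw [mpow_conj hU]
  have : (fun i => d i ^ (0 : ℝ)) = 1 := by ext; simp
  rw [this, realDiagonal_one, Matrix.mul_one, mem_unitaryGroup_iff.1 hU]

theorem mpow_one {A : Mat m} (hA : A.PosDef) : mpow A 1 = A := by
  obtain ⟨U, hU, d, rfl, hd⟩ := exists_realDiagonal_pos hA
  simp [mpow_conj hU]

theorem mlog_mpow {A : Mat m} (hA : A.PosDef) (t : ℝ) : mlog (mpow A t) = t • mlog A := by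
  obtain ⟨U, hU, d, rfl, hd⟩ := exists_realDiagonal_pos hA
  rw [mpow_conj hU, mlog_conj hU, mlog_conj hU]
  have : realDiagonal (fun i => Real.log (d i ^ t))
      = t • realDiagonal (fun i => Real.log (d i)) := by
    ext i j
    by_cases h : i = j
    · subst h; simp [realDiagonal, Real.log_rpow (hd i)]
    · simp [realDiagonal, h]
  rw [this, Matrix.mul_smul, Matrix.smul_mul]

end SpectralCalculus

section FrobeniusNorm

open Matrix

variable {m : ℕ}

theorem norm_sq_eq_sum (A : Mat m) : ‖A‖ ^ 2 = ∑ i, ∑ j, ‖A i j‖ ^ 2 := by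
  rw [frobenius_norm_def, ← Real.sqrt_eq_rpow, Real.sq_sqrt (by positivity)]
  simp

theorem fnorm_eq_norm (A : Mat m) : fnorm A = ‖A‖ := by
  rw [fnorm, ← norm_sq_eq_sum, Real.sqrt_sq (norm_nonneg _)]

theorem norm_sq_eq_trace (A : Mat m) : ((‖A‖ ^ 2 : ℝ) : ℂ) = (star A * A).trace := by
  rw [norm_sq_eq_sum, Matrix.trace, Finset.sum_comm]
  push_cast
  refine Finset.sum_congr rfl fun i _ => ?_
  rw [diag_apply, Matrix.mul_apply]
  refine Finset.sum_congr rfl fun j _ => ?_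
  rw [star_apply, RCLike.star_def, RCLike.conj_mul]
  rfl

theorem norm_unitary_mul {U : Mat m} (hU : U ∈ unitaryGroup (Fin m) ℂ) (A : Mat m) :
    ‖U * A‖ = ‖A‖ := by
  have h : ((‖U * A‖ ^ 2 : ℝ) : ℂ) = ((‖A‖ ^ 2 : ℝ) : ℂ) := by
    rw [norm_sq_eq_trace, norm_sq_eq_trace, StarMul.star_mul, Matrix.mul_assoc,
      ← Matrix.mul_assoc (star U), mem_unitaryGroup_iff'.1 hU, Matrix.one_mul]
  exact (sq_eq_sq₀ (norm_nonneg _) (norm_nonneg _)).1 (by exact_mod_cast h)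

theorem norm_mul_unitary {U : Mat m} (hU : U ∈ unitaryGroup (Fin m) ℂ) (A : Mat m) :
    ‖A * U‖ = ‖A‖ := by
  rw [← frobenius_norm_conjTranspose, conjTranspose_mul, ← star_eq_conjTranspose U,
    norm_unitary_mul (Unitary.star_mem hU), frobenius_norm_conjTranspose]

theorem norm_sq_conj {U : Mat m} (hU : U ∈ unitaryGroup (Fin m) ℂ) (d : Fin m → ℝ) :
    ‖U * realDiagonal d * star U‖ ^ 2 = ∑ i, d i ^ 2 := by
  rw [norm_mul_unitary (Unitary.star_mem hU), norm_unitary_mul hU, realDiagonal, norm_sq_eq_sum]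
  refine Finset.sum_congr rfl fun i _ => ?_
  rw [Finset.sum_eq_single i]
  · simp
  · intro j _ hj; simp [diagonal_apply_ne' _ hj]
  · simp

theorem abs_le_norm_conj {U : Mat m} (hU : U ∈ unitaryGroup (Fin m) ℂ) (d : Fin m → ℝ)
    (i : Fin m) : |d i| ≤ ‖U * realDiagonal d * star U‖ := by
  refine abs_le_of_sq_le_sq' ?_ (norm_nonneg _) |> abs_le.2
  rw [norm_sq_conj hU]
  exact Finset.single_le_sum (f := fun i => d i ^ 2) (fun i _ => sq_nonneg _) (Finset.mem_univ i)

theorem norm_conj_le {U : Mat m} (hU : U ∈ unitaryGroup (Fin m) ℂ) {d : Fin m → ℝ} {r : ℝ}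
    (hr : 0 ≤ r) (hd : ∀ i, |d i| ≤ r) : ‖U * realDiagonal d * star U‖ ≤ √m * r := by
  refine le_of_sq_le_sq ?_ (by positivity)
  rw [norm_sq_conj hU, mul_pow, Real.sq_sqrt (by positivity)]
  calc ∑ i, d i ^ 2 ≤ ∑ _i : Fin m, r ^ 2 :=
        Finset.sum_le_sum fun i _ => sq_le_sq' (abs_le.1 (hd i)).1 (abs_le.1 (hd i)).2
    _ = m * r ^ 2 := by simp

/-- Off-diagonal expansion of the difference of two Hermitian matrices in their eigenbases. -/
theorem norm_sq_conj_sub_conj {U V : Mat m} (hU : U ∈ unitaryGroup (Fin m) ℂ)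
    (hV : V ∈ unitaryGroup (Fin m) ℂ) (d e : Fin m → ℝ) :
    ‖U * realDiagonal d * star U - V * realDiagonal e * star V‖ ^ 2
      = ∑ i, ∑ j, ‖(star V * U) i j‖ ^ 2 * (d j - e i) ^ 2 := by
  rw [← norm_unitary_mul (Unitary.star_mem hV), ← norm_mul_unitary hU, norm_sq_eq_sum]
  refine Finset.sum_congr rfl fun i _ => Finset.sum_congr rfl fun j _ => ?_
  rw [Matrix.mul_sub, Matrix.sub_mul, Matrix.sub_apply, star_mul_conj_mul hU,
    star_mul_conj_mul' hV, mul_comm _ ((star V * U) i j), ← mul_sub, norm_mul, mul_pow,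
    ← Complex.ofReal_sub, Complex.norm_real, Real.norm_eq_abs, sq_abs]

theorem sum_norm_sq_row {W : Mat m} (hW : W ∈ unitaryGroup (Fin m) ℂ) (i : Fin m) :
    ∑ j, ‖W i j‖ ^ 2 = 1 := by
  have h := congrFun (congrFun (mem_unitaryGroup_iff.1 hW) i) i
  rw [Matrix.mul_apply, one_apply_eq] at h
  have h2 : ((∑ j, ‖W i j‖ ^ 2 : ℝ) : ℂ) = 1 := by
    rw [← h]
    push_cast
    refine Finset.sum_congr rfl fun j _ => ?_
    rw [star_apply, RCLike.star_def, RCLike.mul_conj]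
    rfl
  exact_mod_cast h2

theorem exists_abs_sub_le {U V : Mat m} (hU : U ∈ unitaryGroup (Fin m) ℂ)
    (hV : V ∈ unitaryGroup (Fin m) ℂ) (d e : Fin m → ℝ) (i : Fin m) :
    ∃ j, |d j - e i| ≤ ‖U * realDiagonal d * star U - V * realDiagonal e * star V‖ := by
  by_contra! h
  have hW : star V * U ∈ unitaryGroup (Fin m) ℂ := mul_mem (Unitary.star_mem hV) hU
  set r := ‖U * realDiagonal d * star U - V * realDiagonal e * star V‖ with hr
  have h1 : ∑ j, ‖(star V * U) i j‖ ^ 2 * (d j - e i) ^ 2 ≤ r ^ 2 := by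
    rw [hr, norm_sq_conj_sub_conj hU hV]
    exact Finset.single_le_sum (f := fun i => ∑ j, ‖(star V * U) i j‖ ^ 2 * (d j - e i) ^ 2)
      (fun i _ => by positivity) (Finset.mem_univ i)
  have hne : (∑ j, ‖(star V * U) i j‖ ^ 2) ≠ 0 := by simp [sum_norm_sq_row hW i]
  obtain ⟨j, -, hj⟩ := Finset.exists_ne_zero_of_sum_ne_zero hne
  have h2 : ∑ j, ‖(star V * U) i j‖ ^ 2 * r ^ 2
      < ∑ j, ‖(star V * U) i j‖ ^ 2 * (d j - e i) ^ 2 := by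
    have h3 : ∀ k, r ^ 2 < (d k - e i) ^ 2 := fun k => by
      rw [← sq_abs (d k - e i)]
      exact pow_lt_pow_left₀ (h k) (norm_nonneg _) two_ne_zero
    refine Finset.sum_lt_sum (fun k _ => mul_le_mul_of_nonneg_left (h3 k).le (by positivity))
      ⟨j, Finset.mem_univ j, mul_lt_mul_of_pos_left (h3 j) (by positivity)⟩
  rw [← Finset.sum_mul, sum_norm_sq_row hW i, one_mul] at h2
  linarith

theorem norm_matFun_sub_le {U V : Mat m} (hU : U ∈ unitaryGroup (Fin m) ℂ)
    (hV : V ∈ unitaryGroup (Fin m) ℂ) (d e : Fin m → ℝ) (f : ℝ → ℝ) {K : ℝ} (hK : 0 ≤ K)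
    (h : ∀ i j, |f (d j) - f (e i)| ≤ K * |d j - e i|) :
    ‖matFun f (U * realDiagonal d * star U) - matFun f (V * realDiagonal e * star V)‖
      ≤ K * ‖U * realDiagonal d * star U - V * realDiagonal e * star V‖ := by
  refine le_of_sq_le_sq ?_ (by positivity)
  rw [mul_pow, matFun_conj hU, matFun_conj hV, norm_sq_conj_sub_conj hU hV,
    norm_sq_conj_sub_conj hU hV, Finset.mul_sum]
  refine Finset.sum_le_sum fun i _ => ?_
  rw [Finset.mul_sum]
  refine Finset.sum_le_sum fun j _ => ?_
  have := pow_le_pow_left₀ (abs_nonneg _) (h i j) 2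
  rw [mul_pow, sq_abs, sq_abs] at this
  calc _ ≤ ‖(star V * U) i j‖ ^ 2 * (K ^ 2 * (d j - e i) ^ 2) := by gcongr
    _ = _ := by ring

theorem continuousOn_matFun {f : ℝ → ℝ} (hf : ContDiffOn ℝ 1 f (Set.Ioi 0)) :
    ContinuousOn (matFun f : Mat m → Mat m) {A | A.PosDef} := by
  intro A hA
  obtain ⟨U, hU, d, rfl, hd⟩ := exists_realDiagonal_pos hA
  obtain ⟨c, hc, hcd⟩ : ∃ c > 0, ∀ i, c ≤ d i := by
    rcases isEmpty_or_nonempty (Fin m) with h | h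
    · exact ⟨1, one_pos, fun i => h.elim i⟩
    · obtain ⟨i, hi⟩ := Finite.exists_min d
      exact ⟨d i, hd i, hi⟩
  obtain ⟨C, hC⟩ : ∃ C, ∀ i, d i ≤ C :=
    ⟨_, fun i => (le_abs_self _).trans (abs_le_norm_conj hU d i)⟩
  obtain ⟨K, hK⟩ := (hf.mono (s := Set.Ioi 0) (t := Set.Icc (c / 2) (C + c / 2)) (fun x hx =>
    lt_of_lt_of_le (by positivity) hx.1)).exists_lipschitzOnWith one_ne_zero (convex_Icc _ _)
    isCompact_Icc
  refine tendsto_iff_norm_sub_tendsto_zero.2 ?_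
  have hlim : Filter.Tendsto (fun B : Mat m => (K : ℝ) * ‖B - U * realDiagonal d * star U‖)
      (nhdsWithin (U * realDiagonal d * star U) {A | A.PosDef}) (nhds 0) := by
    have : Filter.Tendsto (fun B : Mat m => (K : ℝ) * ‖B - U * realDiagonal d * star U‖)
      (nhds (U * realDiagonal d * star U)) (nhds 0) := by
      have h := (tendsto_iff_norm_sub_tendsto_zero.1
        (Filter.tendsto_id (x := nhds (U * realDiagonal d * star U)))).const_mul (K : ℝ)
      simpa using h
    exact this.mono_left nhdsWithin_le_nhds
  refine squeeze_zero' (Filter.Eventually.of_forall fun B => norm_nonneg _) ?_ hlim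
  have hball : ∀ᶠ B in nhdsWithin (U * realDiagonal d * star U) {A : Mat m | A.PosDef},
      ‖B - U * realDiagonal d * star U‖ < c / 2 := by
    refine nhdsWithin_le_nhds ?_
    have := Metric.ball_mem_nhds (U * realDiagonal d * star U) (half_pos hc)
    filter_upwards [this] with B hB
    rwa [← mem_ball_iff_norm]
  filter_upwards [hball, self_mem_nhdsWithin] with B hB hBpos
  obtain ⟨V, hV, e, rfl, he⟩ := exists_realDiagonal_pos hBpos
  rw [norm_sub_rev (matFun f _), norm_sub_rev (V * _ * _)]
  rw [norm_sub_rev] at hB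
  refine norm_matFun_sub_le hU hV d e f K.2 fun i j => ?_
  have := hK.dist_le_mul (d j) ⟨by linarith [hcd j], by linarith [hC j]⟩ (e i) ?_
  · rwa [Real.dist_eq, Real.dist_eq] at this
  · obtain ⟨k, hk⟩ := exists_abs_sub_le hU hV d e i
    have := abs_le.1 hk
    exact ⟨by linarith [hcd k], by linarith [hC k]⟩

theorem continuousOn_mlog : ContinuousOn (mlog : Mat m → Mat m) {A | A.PosDef} :=
  continuousOn_matFun fun _ hx => (Real.contDiffAt_log.2 (ne_of_gt hx)).contDiffWithinAt

theorem continuousOn_mpow (t : ℝ) : ContinuousOn (fun A : Mat m => mpow A t) {A | A.PosDef} :=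
  continuousOn_matFun fun _ hx =>
    (Real.contDiffAt_rpow_const_of_ne (ne_of_gt hx)).contDiffWithinAt

end FrobeniusNorm

section ThompsonBall

open Matrix

variable {m : ℕ}

/-- The relation `exp (-r) A ≤ B ≤ exp r A` in the Loewner order. -/
def InThompsonBall (r : ℝ) (A B : Mat m) : Prop :=
  (B - Real.exp (-r) • A).PosSemidef ∧ (Real.exp r • A - B).PosSemidef

theorem posSemidef_smul {A : Mat m} (hA : A.PosSemidef) {c : ℝ} (hc : 0 ≤ c) :
    (c • A).PosSemidef := by
  have h := hA.smul (α := ℂ) (a := (c : ℂ)) (by exact_mod_cast hc)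
  rwa [Complex.coe_smul] at h

theorem InThompsonBall.symm {r : ℝ} {A B : Mat m} (h : InThompsonBall r A B) :
    InThompsonBall r B A := by
  constructor
  · convert posSemidef_smul h.2 (Real.exp_nonneg (-r)) using 1
    rw [smul_sub, smul_smul, ← Real.exp_add, neg_add_cancel, Real.exp_zero, one_smul]
  · convert posSemidef_smul h.1 (Real.exp_nonneg r) using 1
    rw [smul_sub, smul_smul, ← Real.exp_add, add_neg_cancel, Real.exp_zero, one_smul]

theorem InThompsonBall.trans {r s : ℝ} {A B C : Mat m} (h : InThompsonBall r A B)
    (h' : InThompsonBall s B C) : InThompsonBall (r + s) A C := by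
  constructor
  · convert h'.1.add (posSemidef_smul h.1 (Real.exp_nonneg (-s))) using 1
    rw [smul_sub, smul_smul, ← Real.exp_add, neg_add_rev]
    abel
  · convert h'.2.add (posSemidef_smul h.2 (Real.exp_nonneg s)) using 1
    rw [smul_sub, smul_smul, ← Real.exp_add, add_comm s r]
    abel

theorem InThompsonBall.conj {r : ℝ} {A B : Mat m} (h : InThompsonBall r A B) (Q : Mat m) :
    InThompsonBall r (Q * A * star Q) (Q * B * star Q) := by
  constructor
  · convert h.1.mul_mul_conjTranspose_same Q using 1
    rw [Matrix.mul_sub, Matrix.sub_mul, Matrix.mul_smul, Matrix.smul_mul, star_eq_conjTranspose]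
  · convert h.2.mul_mul_conjTranspose_same Q using 1
    rw [Matrix.mul_sub, Matrix.sub_mul, Matrix.mul_smul, Matrix.smul_mul, star_eq_conjTranspose]

theorem conj_realDiagonal_sub_smul_one {U : Mat m} (hU : U ∈ unitaryGroup (Fin m) ℂ)
    (d : Fin m → ℝ) (c : ℝ) :
    U * realDiagonal d * star U - c • (1 : Mat m)
      = U * realDiagonal (fun i => d i - c) * star U := by
  have h : realDiagonal (fun i => d i - c) = realDiagonal d - c • (1 : Mat m) := by
    ext i j
    by_cases h : i = j
    · subst h; simp [realDiagonal]
    · simp [realDiagonal, h]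
  rw [h, Matrix.mul_sub, Matrix.sub_mul, Matrix.mul_smul, Matrix.smul_mul, Matrix.mul_one,
    mem_unitaryGroup_iff.1 hU]

theorem smul_one_sub_conj_realDiagonal {U : Mat m} (hU : U ∈ unitaryGroup (Fin m) ℂ)
    (d : Fin m → ℝ) (c : ℝ) :
    c • (1 : Mat m) - U * realDiagonal d * star U
      = U * realDiagonal (fun i => c - d i) * star U := by
  have h : realDiagonal (fun i => c - d i) = c • (1 : Mat m) - realDiagonal d := by
    ext i j
    by_cases h : i = j
    · subst h; simp [realDiagonal]
    · simp [realDiagonal, h]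
  rw [h, Matrix.mul_sub, Matrix.sub_mul, Matrix.mul_smul, Matrix.smul_mul, Matrix.mul_one,
    mem_unitaryGroup_iff.1 hU]

theorem inThompsonBall_one_conj_iff {U : Mat m} (hU : U ∈ unitaryGroup (Fin m) ℂ)
    {d : Fin m → ℝ} (hd : ∀ i, 0 < d i) (r : ℝ) :
    InThompsonBall r 1 (U * realDiagonal d * star U) ↔ ∀ i, |Real.log (d i)| ≤ r := by
  rw [InThompsonBall, conj_realDiagonal_sub_smul_one hU, smul_one_sub_conj_realDiagonal hU,
    posSemidef_conj_iff hU, posSemidef_conj_iff hU, ← forall_and]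
  refine forall_congr' fun i => ?_
  rw [sub_nonneg, sub_nonneg, abs_le, Real.le_log_iff_exp_le (hd i), Real.log_le_iff_le_exp (hd i)]

theorem inThompsonBall_norm_mlog {N : Mat m} (hN : N.PosDef) : InThompsonBall ‖mlog N‖ 1 N := by
  obtain ⟨U, hU, d, rfl, hd⟩ := exists_realDiagonal_pos hN
  rw [inThompsonBall_one_conj_iff hU hd, mlog_conj hU]
  exact abs_le_norm_conj hU fun i => Real.log (d i)

theorem InThompsonBall.norm_mlog_le {N : Mat m} (hN : N.PosDef) {r : ℝ} (hr : 0 ≤ r)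
    (h : InThompsonBall r 1 N) : ‖mlog N‖ ≤ √m * r := by
  obtain ⟨U, hU, d, rfl, hd⟩ := exists_realDiagonal_pos hN
  rw [inThompsonBall_one_conj_iff hU hd] at h
  rw [mlog_conj hU]
  exact norm_conj_le hU hr h

/-- The logarithm `log (X^{-1/2} A X^{-1/2})` of `A` relative to the base point `X`. -/
noncomputable def relLog (X A : Mat m) : Mat m :=
  mlog (mpow X (-(1/2 : ℝ)) * A * mpow X (-(1/2 : ℝ)))

theorem karcherLHS_eq (X : Mat m) (μ : Measure (Mat m)) :
    karcherLHS X μ = ∫ A, relLog X A ∂μ := rfl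

theorem rdist_eq (A B : Mat m) : rdist A B = ‖relLog A B‖ := fnorm_eq_norm _

theorem mpow_half_neg_mul {X : Mat m} (hX : X.PosDef) :
    mpow X (1/2 : ℝ) * mpow X (-(1/2 : ℝ)) = 1 := by
  rw [mpow_mul_mpow hX, add_neg_cancel, mpow_zero hX]

theorem mpow_neg_half_mul {X : Mat m} (hX : X.PosDef) :
    mpow X (-(1/2 : ℝ)) * mpow X (1/2 : ℝ) = 1 := by
  rw [mpow_mul_mpow hX, neg_add_cancel, mpow_zero hX]

theorem mpow_half_mul_self {X : Mat m} (hX : X.PosDef) :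
    mpow X (1/2 : ℝ) * mpow X (1/2 : ℝ) = X := by
  rw [mpow_mul_mpow hX, add_halves, mpow_one hX]

theorem mpow_neg_half_conj_self {X : Mat m} (hX : X.PosDef) :
    mpow X (-(1/2 : ℝ)) * X * mpow X (-(1/2 : ℝ)) = 1 := by
  have h := mpow_mul_mpow hX (-(1/2)) 1
  rw [mpow_one hX] at h
  rw [h, mpow_mul_mpow hX, ← mpow_zero hX]
  norm_num

theorem mpow_half_conj_mpow_neg_half_conj {X : Mat m} (hX : X.PosDef) (A : Mat m) :
    mpow X (1/2 : ℝ) * (mpow X (-(1/2 : ℝ)) * A * mpow X (-(1/2 : ℝ))) * mpow X (1/2 : ℝ)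
      = A := by
  calc _ = (mpow X (1/2 : ℝ) * mpow X (-(1/2 : ℝ))) * A
        * (mpow X (-(1/2 : ℝ)) * mpow X (1/2 : ℝ)) := by simp only [Matrix.mul_assoc]
    _ = A := by rw [mpow_half_neg_mul hX, mpow_neg_half_mul hX, Matrix.one_mul, Matrix.mul_one]

theorem mpow_neg_half_conj_mpow_half_conj {X : Mat m} (hX : X.PosDef) (A : Mat m) :
    mpow X (-(1/2 : ℝ)) * (mpow X (1/2 : ℝ) * A * mpow X (1/2 : ℝ)) * mpow X (-(1/2 : ℝ))
      = A := by
  calc _ = (mpow X (-(1/2 : ℝ)) * mpow X (1/2 : ℝ)) * A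
        * (mpow X (1/2 : ℝ) * mpow X (-(1/2 : ℝ))) := by simp only [Matrix.mul_assoc]
    _ = A := by rw [mpow_half_neg_mul hX, mpow_neg_half_mul hX, Matrix.one_mul, Matrix.mul_one]

theorem posDef_mpow_conj {X A : Mat m} (hX : X.PosDef) (hA : A.PosDef) (s : ℝ) :
    (mpow X s * A * mpow X s).PosDef := by
  have h := (Matrix.IsUnit.posDef_star_right_conjugate_iff (posDef_mpow hX s).isUnit).2 hA
  rwa [star_mpow hX] at h

theorem inThompsonBall_norm_relLog {X A : Mat m} (hX : X.PosDef) (hA : A.PosDef) :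
    InThompsonBall ‖relLog X A‖ X A := by
  have h := (inThompsonBall_norm_mlog (posDef_mpow_conj hX hA (-(1/2 : ℝ)))).conj
    (mpow X (1/2 : ℝ))
  rwa [star_mpow hX, Matrix.mul_one, mpow_half_mul_self hX,
    mpow_half_conj_mpow_neg_half_conj hX] at h

theorem InThompsonBall.norm_relLog_le {X A : Mat m} (hX : X.PosDef) (hA : A.PosDef) {r : ℝ}
    (hr : 0 ≤ r) (h : InThompsonBall r X A) : ‖relLog X A‖ ≤ √m * r := by
  have h' := h.conj (mpow X (-(1/2 : ℝ)))
  rw [star_mpow hX, mpow_neg_half_conj_self hX] at h'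
  exact h'.norm_mlog_le (posDef_mpow_conj hX hA _) hr

theorem norm_relLog_triangle {X Y A : Mat m} (hX : X.PosDef) (hY : Y.PosDef) (hA : A.PosDef) :
    ‖relLog Y A‖ ≤ √m * (‖relLog X Y‖ + ‖relLog X A‖) :=
  ((inThompsonBall_norm_relLog hX hY).symm.trans (inThompsonBall_norm_relLog hX hA)).norm_relLog_le
    hY hA (by positivity)

theorem norm_relLog_comm_le {X A : Mat m} (hX : X.PosDef) (hA : A.PosDef) :
    ‖relLog A X‖ ≤ √m * ‖relLog X A‖ :=
  (inThompsonBall_norm_relLog hX hA).symm.norm_relLog_le hA hX (norm_nonneg _)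

theorem posDef_geom {X A : Mat m} (hX : X.PosDef) (hA : A.PosDef) (t : ℝ) :
    (geom X t A).PosDef :=
  posDef_mpow_conj hX (posDef_mpow (posDef_mpow_conj hX hA _) t) _

theorem relLog_geom {X A : Mat m} (hX : X.PosDef) (hA : A.PosDef) (t : ℝ) :
    relLog X (geom X t A) = t • relLog X A := by
  rw [relLog, geom, mpow_neg_half_conj_mpow_half_conj hX,
    mlog_mpow (posDef_mpow_conj hX hA _), relLog]

theorem continuousOn_relLog {X : Mat m} (hX : X.PosDef) :
    ContinuousOn (relLog X) {A | A.PosDef} := by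
  refine continuousOn_mlog.comp (t := {A | A.PosDef}) (by fun_prop) fun A hA => ?_
  exact posDef_mpow_conj hX hA _

theorem continuousOn_relLog_left {X : Mat m} (hX : X.PosDef) :
    ContinuousOn (fun A => relLog A X) {A | A.PosDef} := by
  refine continuousOn_mlog.comp (t := {A | A.PosDef}) ?_ fun A hA => ?_
  · exact ((continuousOn_mpow _).mul continuousOn_const).mul (continuousOn_mpow _)
  · exact posDef_mpow_conj hA hX _

end ThompsonBall

section FirstOrder

open Matrix

variable {m : ℕ}

theorem abs_log_sub_le {x : ℝ} (hx : |x - 1| ≤ 1 / 2) :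
    |Real.log x - (x - 1)| ≤ 2 * (x - 1) ^ 2 := by
  have h := abs_le.1 hx
  have hx0 : 0 < x := by linarith
  have h1 := Real.log_le_sub_one_of_pos hx0
  have h2 := Real.one_sub_inv_le_log_of_pos hx0
  have h3 : x - 1 - 2 * (x - 1) ^ 2 ≤ 1 - x⁻¹ := by
    have : 1 - x⁻¹ - (x - 1 - 2 * (x - 1) ^ 2) = (x - 1) ^ 2 * (2 * x - 1) / x := by
      field_simp; ring
    have : 0 ≤ (x - 1) ^ 2 * (2 * x - 1) / x :=
      div_nonneg (mul_nonneg (sq_nonneg _) (by linarith)) hx0.le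
    linarith
  rw [abs_le]
  constructor <;> nlinarith [sq_nonneg (x - 1)]

theorem norm_mlog_sub_le {N : Mat m} (hN : N.PosDef) (h : ‖N - 1‖ ≤ 1 / 2) :
    ‖mlog N - (N - 1)‖ ≤ 2 * ‖N - 1‖ ^ 2 := by
  obtain ⟨U, hU, d, rfl, hd⟩ := exists_realDiagonal_pos hN
  have hsub : U * realDiagonal d * star U - 1 = U * realDiagonal (fun i => d i - 1) * star U := by
    simpa using conj_realDiagonal_sub_smul_one hU d 1
  have hdiff : U * realDiagonal (fun i => Real.log (d i)) * star U
      - U * realDiagonal (fun i => d i - 1) * star U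
      = U * realDiagonal (fun i => Real.log (d i) - (d i - 1)) * star U := by
    rw [← Matrix.sub_mul, ← Matrix.mul_sub]
    congr 2
    ext i j
    by_cases h : i = j
    · subst h; simp [realDiagonal]
    · simp [realDiagonal, h]
  rw [hsub] at h ⊢
  rw [mlog_conj hU, hdiff]
  refine le_of_sq_le_sq ?_ (by positivity)
  rw [norm_sq_conj hU, norm_sq_conj hU, mul_pow]
  have h1 : ∀ i, (Real.log (d i) - (d i - 1)) ^ 2 ≤ 2 ^ 2 * ((d i - 1) ^ 2) ^ 2 := fun i => by
    have := abs_log_sub_le ((abs_le_norm_conj hU (fun i => d i - 1) i).trans h)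
    rw [← sq_abs, ← mul_pow]
    exact pow_le_pow_left₀ (abs_nonneg _) this 2
  refine (Finset.sum_le_sum fun i _ => h1 i).trans ?_
  rw [← Finset.mul_sum]
  gcongr
  exact Finset.sum_sq_le_sq_sum_of_nonneg fun i _ => sq_nonneg _

theorem norm_mlog_le_two_mul {N : Mat m} (hN : N.PosDef) (h : ‖N - 1‖ ≤ 1 / 2) :
    ‖mlog N‖ ≤ 2 * ‖N - 1‖ := by
  have h1 := norm_mlog_sub_le hN h
  have h2 : ‖mlog N‖ ≤ ‖mlog N - (N - 1)‖ + ‖N - 1‖ := by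
    simpa using norm_add_le (mlog N - (N - 1)) (N - 1)
  nlinarith [norm_nonneg (N - 1)]

theorem hasDerivAt_mpow_zero {M : Mat m} (hM : M.PosDef) :
    HasDerivAt (fun t : ℝ => mpow M t) (mlog M) 0 := by
  obtain ⟨U, hU, d, rfl, hd⟩ := exists_realDiagonal_pos hM
  let Φ : (Fin m → ℝ) →ₗ[ℝ] Mat m :=
    { toFun := fun e => U * realDiagonal e * star U
      map_add' := fun e f => by
        rw [← Matrix.add_mul, ← Matrix.mul_add]
        congr 2
        ext i j
        by_cases h : i = j
        · subst h; simp [realDiagonal]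
        · simp [realDiagonal, h]
      map_smul' := fun c e => by
        rw [RingHom.id_apply, ← Matrix.smul_mul, ← Matrix.mul_smul]
        congr 2
        ext i j
        by_cases h : i = j
        · subst h; simp [realDiagonal]
        · simp [realDiagonal, h] }
  have h1 : HasDerivAt (fun t : ℝ => fun i => d i ^ t) (fun i => Real.log (d i)) 0 := by
    rw [hasDerivAt_pi]
    intro i
    simpa using (hasDerivAt_id (0 : ℝ)).const_rpow (hd i)
  have h2 := (LinearMap.toContinuousLinearMap Φ).hasFDerivAt.comp_hasDerivAt (0 : ℝ) h1
  simp only [mpow_conj hU, mlog_conj hU]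
  exact h2

end FirstOrder

section LogTraceInequality

open Matrix

variable {m : ℕ}

theorem re_trace_mul_conj (T : Mat m) (U : Mat m) {V : Mat m}
    (hV : V ∈ unitaryGroup (Fin m) ℂ) (d : Fin m → ℝ) :
    (star T * T * (U * realDiagonal d * star U)).trace.re
      = ∑ i, ∑ j, ‖(star V * T * U) i j‖ ^ 2 * d j := by
  set W := star V * T * U with hW
  have h1 : (star T * T * (U * realDiagonal d * star U)).trace
      = (star W * W * realDiagonal d).trace := by
    have h2 : star W * W = star U * (star T * T) * U := by
      rw [hW]
      simp only [StarMul.star_mul, star_star, Matrix.mul_assoc]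
      rw [← Matrix.mul_assoc V (star V), mem_unitaryGroup_iff.1 hV, Matrix.one_mul]
    rw [h2, ← Matrix.mul_assoc, Matrix.trace_mul_comm]
    simp only [Matrix.mul_assoc]
  rw [h1, realDiagonal, Matrix.trace, Finset.sum_comm]
  rw [Complex.re_sum]
  refine Finset.sum_congr rfl fun j _ => ?_
  rw [diag_apply, mul_diagonal, Matrix.mul_apply, Complex.re_mul_ofReal, Complex.re_sum,
    Finset.sum_mul]
  refine Finset.sum_congr rfl fun i _ => ?_
  rw [star_apply, RCLike.star_def, RCLike.conj_mul]
  norm_cast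

theorem re_trace_mul_conj' (T : Mat m) {U : Mat m} (V : Mat m)
    (hU : U ∈ unitaryGroup (Fin m) ℂ) (e : Fin m → ℝ) :
    (T * star T * (V * realDiagonal e * star V)).trace.re
      = ∑ i, ∑ j, ‖(star V * T * U) i j‖ ^ 2 * e i := by
  have h := re_trace_mul_conj (star T) V hU e
  rw [star_star] at h
  rw [h, Finset.sum_comm]
  refine Finset.sum_congr rfl fun i _ => Finset.sum_congr rfl fun j _ => ?_
  have : star U * star T * V = star (star V * T * U) := by
    simp [StarMul.star_mul, Matrix.mul_assoc]
  rw [this, star_apply, norm_star]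

theorem one_sub_sq_le_neg_log_mul {y : ℝ} (hy : 0 < y) :
    (1 - y) ^ 2 ≤ -Real.log y * (1 - y ^ 2) := by
  rcases le_total y 1 with h | h
  · have h1 := Real.log_le_sub_one_of_pos hy
    nlinarith [mul_nonneg (sub_nonneg.2 h) (by linarith : 0 ≤ -Real.log y - (1 - y)),
      mul_nonneg hy.le (mul_nonneg (sub_nonneg.2 h) (by linarith : 0 ≤ -Real.log y))]
  · have h1 := Real.one_sub_inv_le_log_of_pos hy
    have h2 : (y - 1) ^ 2 ≤ (1 - y⁻¹) * (y ^ 2 - 1) := by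
      have : (1 - y⁻¹) * (y ^ 2 - 1) - (y - 1) ^ 2 = (y - 1) ^ 2 * y⁻¹ := by field_simp; ring
      have : 0 ≤ (y - 1) ^ 2 * y⁻¹ := by positivity
      linarith
    have h3 : (1 - y⁻¹) * (y ^ 2 - 1) ≤ Real.log y * (y ^ 2 - 1) :=
      mul_le_mul_of_nonneg_right h1 (by nlinarith)
    nlinarith

theorem norm_sub_sq_le_log {a b : ℝ} (ha : 0 < a) (hb : 0 < b) {p q : ℂ}
    (h : (b : ℂ) * p = q * a) :
    ‖p - q‖ ^ 2 ≤ (Real.log a - Real.log b) * (‖p‖ ^ 2 - ‖q‖ ^ 2) := by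
  have ha' : (a : ℂ) ≠ 0 := by exact_mod_cast ha.ne'
  have hq : q = ((b / a : ℝ) : ℂ) * p := by
    push_cast
    field_simp
    rw [h]
  have hy : 0 < b / a := by positivity
  have h1 := one_sub_sq_le_neg_log_mul hy
  rw [Real.log_div hb.ne' ha.ne'] at h1
  have h2 : p - q = ((1 - b / a : ℝ) : ℂ) * p := by rw [hq]; push_cast; ring
  rw [h2, hq, norm_mul, norm_mul, Complex.norm_real, Complex.norm_real, mul_pow, mul_pow,
    Real.norm_eq_abs, Real.norm_eq_abs, sq_abs, sq_abs]
  nlinarith [mul_le_mul_of_nonneg_right h1 (sq_nonneg ‖p‖)]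

/-- Strong monotonicity of the logarithm along congruences. -/
theorem norm_star_inv_sub_sq_le {M Q R : Mat m} (hM : M.PosDef) (hRQ : R * Q = 1) :
    ‖star R - Q‖ ^ 2 ≤ ((R * star R - star Q * Q) * mlog M).trace.re
      - ((star R * R - Q * star Q) * mlog (Q * M * star Q)).trace.re := by
  have hQR : star Q * star R = 1 := by rw [← StarMul.star_mul, hRQ, star_one]
  have hN : (Q * M * star Q).PosDef :=
    (Matrix.IsUnit.posDef_star_right_conjugate_iff
      (IsUnit.of_mul_eq_one R (mul_eq_one_comm.1 hRQ))).2 hM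
  obtain ⟨U, hU, a, hMU, ha⟩ := exists_realDiagonal_pos hM
  obtain ⟨V, hV, b, hNV, hb⟩ := exists_realDiagonal_pos hN
  have hNR : (Q * M * star Q) * star R = Q * M := by
    rw [Matrix.mul_assoc, hQR, Matrix.mul_one]
  rw [hNV] at hNR ⊢
  rw [hMU] at hNR ⊢
  have hpq : ∀ i j, (b i : ℂ) * (star V * star R * U) i j = (star V * Q * U) i j * a j := by
    intro i j
    have h1 := star_mul_conj_mul' (U := star R * U) hV b i j
    have h3 : star V * (Q * (U * realDiagonal a * star U)) * U
        = (star V * Q * U) * realDiagonal a := by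
      calc _ = star V * Q * U * realDiagonal a * (star U * U) := by simp only [Matrix.mul_assoc]
        _ = _ := by rw [mem_unitaryGroup_iff'.1 hU, Matrix.mul_one]
    have h4 : (star V * Q * U * realDiagonal a) i j = (star V * Q * U) i j * a j :=
      mul_diagonal _ _ _ _
    rw [Matrix.mul_assoc (star V) (star R), ← h1, ← h4, ← h3, ← hNR]
    simp only [Matrix.mul_assoc]
  rw [mlog_conj hU, mlog_conj hV, Matrix.sub_mul, Matrix.sub_mul, Matrix.trace_sub,
    Matrix.trace_sub, Complex.sub_re, Complex.sub_re]
  have e1 := re_trace_mul_conj (star R) U hV (fun i => Real.log (a i))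
  have e2 := re_trace_mul_conj' (star R) V hU (fun i => Real.log (b i))
  rw [star_star] at e1 e2
  rw [e1, e2, re_trace_mul_conj Q U hV, re_trace_mul_conj' Q V hU,
    ← norm_unitary_mul (Unitary.star_mem hV), ← norm_mul_unitary hU, norm_sq_eq_sum]
  simp only [← Finset.sum_sub_distrib]
  refine Finset.sum_le_sum fun i _ => Finset.sum_le_sum fun j _ => ?_
  rw [Matrix.mul_sub, Matrix.sub_mul, Matrix.sub_apply]
  refine (norm_sub_sq_le_log (ha j) (hb i) (hpq i j)).trans (le_of_eq ?_)
  ring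

theorem abs_re_trace_mul_le (A B : Mat m) : |(A * B).trace.re| ≤ ‖A‖ * ‖B‖ := by
  refine (Complex.abs_re_le_norm _).trans ?_
  have h1 : ‖(A * B).trace‖ ≤ ∑ p : Fin m × Fin m, ‖A p.1 p.2‖ * ‖B p.2 p.1‖ := by
    rw [Fintype.sum_prod_type, Matrix.trace]
    refine (norm_sum_le _ _).trans (Finset.sum_le_sum fun i _ => ?_)
    rw [diag_apply, Matrix.mul_apply]
    refine (norm_sum_le _ _).trans (Finset.sum_le_sum fun j _ => ?_)
    rw [norm_mul]
  refine h1.trans (le_of_sq_le_sq ?_ (by positivity))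
  refine (Finset.sum_mul_sq_le_sq_mul_sq _ _ _).trans (le_of_eq ?_)
  rw [mul_pow, norm_sq_eq_sum A, norm_sq_eq_sum B, Fintype.sum_prod_type, Fintype.sum_prod_type,
    Finset.sum_comm (f := fun i j => ‖B i j‖ ^ 2)]

theorem norm_mul_star_sub_one_le {Q R : Mat m} (hRQ : R * Q = 1) {ε : ℝ} (hε0 : 0 ≤ ε)
    (hε : ε ≤ 1 / 2) (h : ‖star R - Q‖ ^ 2 ≤ ‖R * star R - star Q * Q‖ * ε) :
    ‖R * star R - 1‖ ≤ 5 * ε := by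
  have hQR : Q * R = 1 := mul_eq_one_comm.1 hRQ
  have hQR' : star Q * star R = 1 := by rw [← StarMul.star_mul, hRQ, star_one]
  have hRQ' : star R * star Q = 1 := by rw [← StarMul.star_mul, hQR, star_one]
  have hB : (R * star R).PosDef := by
    have := (Matrix.IsUnit.posDef_star_right_conjugate_iff
      (IsUnit.of_mul_eq_one Q hRQ)).2 (PosDef.one (n := Fin m) (R := ℂ))
    rwa [Matrix.mul_one] at this
  have hE : ((‖star R - Q‖ ^ 2 : ℝ) : ℂ) = (R * star R + star Q * Q - (2 : ℝ) • 1).trace := by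
    rw [norm_sq_eq_trace, star_sub, star_star, Matrix.sub_mul, Matrix.mul_sub, Matrix.mul_sub,
      hRQ, hQR']
    congr 1
    rw [two_smul]
    abel
  have hinv : R * star R * (star Q * Q) = 1 := by
    rw [Matrix.mul_assoc, ← Matrix.mul_assoc (star R), hRQ', Matrix.one_mul, hRQ]
  obtain ⟨U, hU, b, hBU, hb⟩ := exists_realDiagonal_pos hB
  have hC : star Q * Q = U * realDiagonal (fun i => (b i)⁻¹) * star U := by
    have h1 : R * star R * (U * realDiagonal (fun i => (b i)⁻¹) * star U) = 1 := by
      rw [hBU, conj_realDiagonal_mul hU]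
      have : b * (fun i => (b i)⁻¹) = 1 := by ext i; simp [(hb i).ne']
      rw [this, realDiagonal_one, Matrix.mul_one, mem_unitaryGroup_iff.1 hU]
    exact (left_inv_eq_right_inv (mul_eq_one_comm.1 hinv) h1)
  have hsum : ‖star R - Q‖ ^ 2 = ∑ i, (b i + (b i)⁻¹ - 2) := by
    have h1 : R * star R + star Q * Q - (2 : ℝ) • 1
        = U * realDiagonal (fun i => b i + (b i)⁻¹ - 2) * star U := by
      rw [← conj_realDiagonal_sub_smul_one hU (fun i => b i + (b i)⁻¹), hBU, hC,
        ← Matrix.add_mul, ← Matrix.mul_add]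
      congr 3
      simp [realDiagonal]
    have h2 : (U * realDiagonal (fun i => b i + (b i)⁻¹ - 2) * star U).trace
        = ((∑ i, (b i + (b i)⁻¹ - 2) : ℝ) : ℂ) := by
      rw [Matrix.trace_mul_comm, ← Matrix.mul_assoc, mem_unitaryGroup_iff'.1 hU, Matrix.one_mul,
        realDiagonal, trace_diagonal]
      push_cast
      rfl
    rw [h1, h2] at hE
    exact_mod_cast hE
  have hD : ‖R * star R - star Q * Q‖ ^ 2 = ∑ i, (b i - (b i)⁻¹) ^ 2 := by
    rw [← norm_sq_conj hU, hBU, hC, ← Matrix.sub_mul, ← Matrix.mul_sub]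
    congr 4
    simp [realDiagonal]
  have hF : ‖R * star R - 1‖ ^ 2 = ∑ i, (b i - 1) ^ 2 := by
    rw [← norm_sq_conj hU, hBU, ← conj_realDiagonal_sub_smul_one hU b 1, one_smul]
  set E := ∑ i, (b i + (b i)⁻¹ - 2) with hEdef
  have hnn : ∀ i, 0 ≤ b i + (b i)⁻¹ - 2 := fun i => by
    have : b i + (b i)⁻¹ - 2 = (b i - 1) ^ 2 * (b i)⁻¹ := by
      field_simp [(hb i).ne']; ring
    rw [this]
    have := hb i
    positivity
  have hEsq : ∑ i, (b i + (b i)⁻¹ - 2) ^ 2 ≤ E ^ 2 :=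
    Finset.sum_sq_le_sq_sum_of_nonneg fun i _ => hnn i
  have hE0 : 0 ≤ E := Finset.sum_nonneg fun i _ => hnn i
  have hDE : ‖R * star R - star Q * Q‖ ^ 2 ≤ E ^ 2 + 4 * E := by
    rw [hD]
    calc ∑ i, (b i - (b i)⁻¹) ^ 2
        = ∑ i, (b i + (b i)⁻¹ - 2) ^ 2 + 4 * E := by
          rw [hEdef, Finset.mul_sum, ← Finset.sum_add_distrib]
          refine Finset.sum_congr rfl fun i _ => ?_
          have := hb i
          field_simp
          ring
      _ ≤ _ := by linarith
  have hFE : ‖R * star R - 1‖ ^ 2 ≤ E ^ 2 + 2 * E := by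
    rw [hF]
    calc ∑ i, (b i - 1) ^ 2
        ≤ ∑ i, ((b i + (b i)⁻¹ - 2) ^ 2 + 2 * (b i + (b i)⁻¹ - 2)) := by
          refine Finset.sum_le_sum fun i _ => ?_
          have h0 := hb i
          have h1 : (b i - 1) ^ 2 = b i * (b i + (b i)⁻¹ - 2) := by field_simp; ring
          have h2 : 0 ≤ (b i)⁻¹ * (b i + (b i)⁻¹ - 2) := mul_nonneg (by positivity) (hnn i)
          nlinarith
      _ = ∑ i, (b i + (b i)⁻¹ - 2) ^ 2 + 2 * E := by
          rw [Finset.sum_add_distrib, Finset.mul_sum]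
      _ ≤ _ := by linarith
  rw [hsum] at h
  have hs : ε ^ 2 ≤ 1 / 4 := by nlinarith
  have hEε : E ≤ 6 * ε ^ 2 := by
    have h1 : E ^ 2 ≤ (E ^ 2 + 4 * E) * ε ^ 2 :=
      calc E ^ 2 ≤ (‖R * star R - star Q * Q‖ * ε) ^ 2 := pow_le_pow_left₀ hE0 h 2
        _ ≤ _ := by rw [mul_pow]; gcongr
    rcases hE0.eq_or_lt with h0 | h0
    · rw [← h0]; positivity
    · have h2 : E ≤ (E + 4) * ε ^ 2 := le_of_mul_le_mul_left (by nlinarith) h0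
      nlinarith [mul_le_mul_of_nonneg_left hs hE0]
  refine le_of_sq_le_sq (hFE.trans ?_) (by positivity)
  nlinarith [mul_nonneg hE0 (sub_nonneg.2 hEε), sq_nonneg ε, mul_le_mul_of_nonneg_left hs hE0]

end LogTraceInequality

section Karcher

open Matrix

variable {m : ℕ}

theorem measurableSet_posDef : MeasurableSet {A : Mat m | A.PosDef} := by
  have h : {A : Mat m | A.PosDef} = {A : Mat m | A.PosSemidef} ∩ {A : Mat m | A.det ≠ 0} := by
    ext A
    refine ⟨fun h => ⟨h.posSemidef, h.det_pos.ne'⟩, fun h => ?_⟩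
    exact h.1.posDef_iff_det_ne_zero.2 h.2
  rw [h]
  refine IsClosed.measurableSet ?_ |>.inter (IsOpen.measurableSet ?_)
  · have : {A : Mat m | A.PosSemidef}
        = {A : Mat m | Aᴴ = A} ∩ ⋂ x : Fin m → ℂ, {A | 0 ≤ star x ⬝ᵥ (A *ᵥ x)} := by
      ext A
      simp [posSemidef_iff_dotProduct_mulVec, IsHermitian]
    rw [this]
    refine (isClosed_eq (by fun_prop) (by fun_prop)).inter (isClosed_iInter fun x => ?_)
    exact isClosed_le (by fun_prop) (by fun_prop)
  · exact isOpen_ne_fun (by fun_prop) (by fun_prop)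

/-- The topology of the Frobenius norm; it is definitionally the product topology. -/
noncomputable abbrev frobeniusTopology : TopologicalSpace (Mat m) :=
  (frobeniusNormedAddCommGroup : NormedAddCommGroup (Mat m))
    |>.toPseudoMetricSpace.toUniformSpace.toTopologicalSpace

section FrobeniusTopology

attribute [local instance] frobeniusTopology

theorem aestronglyMeasurable_of_continuousOn_posDef {ν : Measure (Mat m)}
    (hν : ∀ᵐ A ∂ν, A.PosDef) {f : Mat m → Mat m} (hf : ContinuousOn f {A | A.PosDef}) :
    AEStronglyMeasurable f ν := by
  have h1 : Measure.restrict ν {A | A.PosDef} = ν := Measure.restrict_eq_self_of_ae_mem hν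
  have h : AEStronglyMeasurable f (ν.restrict {A | A.PosDef}) :=
    haveI : BorelSpace (Mat m) := ⟨rfl⟩
    hf.aestronglyMeasurable (μ := ν) measurableSet_posDef
  rwa [h1] at h

theorem integrable_relLog {ν : Measure (Mat m)} [IsProbabilityMeasure ν]
    (hν : ∀ᵐ A ∂ν, A.PosDef) (hffm : HasFFM ν) {X : Mat m} (hX : X.PosDef) :
    Integrable (relLog X) ν := by
  obtain ⟨Y, hY, hint⟩ := hffm
  have hg : Integrable (fun A => √m * (‖relLog Y X‖ + √m * rdist A Y)) ν :=
    ((integrable_const _).add (hint.const_mul _)).const_mul _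
  refine hg.mono' (aestronglyMeasurable_of_continuousOn_posDef hν (continuousOn_relLog hX)) ?_
  filter_upwards [hν] with A hA
  refine (norm_relLog_triangle hY hX hA).trans ?_
  rw [rdist_eq]
  gcongr
  exact norm_relLog_comm_le hA hY

theorem hasFFM_of_integrable_relLog {ν : Measure (Mat m)} (hν : ∀ᵐ A ∂ν, A.PosDef) {X : Mat m}
    (hX : X.PosDef) (h : Integrable (relLog X) ν) : HasFFM ν := by
  refine ⟨X, hX, ?_⟩
  simp only [rdist_eq]
  refine (h.norm.const_mul √m).mono'
    (aestronglyMeasurable_of_continuousOn_posDef hν (continuousOn_relLog_left hX)).norm ?_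
  filter_upwards [hν] with A hA
  rw [norm_norm]
  exact norm_relLog_comm_le hX hA

section Pushforward

variable {X : Mat m} {μ : Measure (Mat m)} {t : ℝ}

theorem ae_posDef_map_geom (hX : X.PosDef) (hμ : ∀ᵐ A ∂μ, A.PosDef)
    (hmeas : AEMeasurable (geom X t) μ) : ∀ᵐ A ∂(μ.map (geom X t)), A.PosDef := by
  rw [ae_map_iff hmeas measurableSet_posDef]
  filter_upwards [hμ] with A hA using posDef_geom hX hA t

theorem karcherLHS_map_geom (hX : X.PosDef) (hμ : ∀ᵐ A ∂μ, A.PosDef)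
    (hmeas : AEMeasurable (geom X t) μ) {Y : Mat m} (hY : Y.PosDef) :
    karcherLHS Y (μ.map (geom X t)) = ∫ A, relLog Y (geom X t A) ∂μ :=
  integral_map hmeas (aestronglyMeasurable_of_continuousOn_posDef
    (ae_posDef_map_geom hX hμ hmeas) (continuousOn_relLog hY))

theorem karcherLHS_map_geom_self (hX : X.PosDef) (hμ : ∀ᵐ A ∂μ, A.PosDef)
    (hmeas : AEMeasurable (geom X t) μ) :
    karcherLHS X (μ.map (geom X t)) = t • karcherLHS X μ := by
  rw [karcherLHS_map_geom hX hμ hmeas hX, karcherLHS_eq, ← integral_smul]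
  refine integral_congr_ae ?_
  filter_upwards [hμ] with A hA using relLog_geom hX hA t

theorem hasFFM_map_geom [IsProbabilityMeasure μ] (hX : X.PosDef) (hμ : ∀ᵐ A ∂μ, A.PosDef)
    (hffm : HasFFM μ) (hmeas : AEMeasurable (geom X t) μ) : HasFFM (μ.map (geom X t)) := by
  have hν := ae_posDef_map_geom hX hμ hmeas
  refine hasFFM_of_integrable_relLog hν hX ((integrable_map_measure
    (aestronglyMeasurable_of_continuousOn_posDef hν (continuousOn_relLog hX)) hmeas).2 ?_)
  refine ((integrable_relLog hμ hffm hX).smul t).congr ?_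
  filter_upwards [hμ] with A hA using (relLog_geom hX hA t).symm

end Pushforward

/-- The functional `D ↦ Re tr (C D)`. -/
noncomputable def reTraceMul (C : Mat m) : Mat m →L[ℝ] ℝ :=
  LinearMap.toContinuousLinearMap
    { toFun := fun D => (C * D).trace.re
      map_add' := fun D E => by simp [Matrix.mul_add]
      map_smul' := fun c D => by simp }

theorem reTraceMul_apply (C D : Mat m) : reTraceMul C D = (C * D).trace.re := rfl

theorem norm_conj_sub_one_le {ν : Measure (Mat m)} [IsProbabilityMeasure ν]
    (hν : ∀ᵐ A ∂ν, A.PosDef) (hffm : HasFFM ν) {X Y : Mat m} (hX : X.PosDef) (hY : Y.PosDef)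
    (hYν : karcherLHS Y ν = 0) (hXν : ‖karcherLHS X ν‖ ≤ 1 / 2) :
    ‖mpow X (-(1/2 : ℝ)) * Y * mpow X (-(1/2 : ℝ)) - 1‖ ≤ 5 * ‖karcherLHS X ν‖ := by
  set Q := mpow Y (-(1/2 : ℝ)) * mpow X (1/2 : ℝ) with hQ
  set R := mpow X (-(1/2 : ℝ)) * mpow Y (1/2 : ℝ) with hR
  have hRQ : R * Q = 1 := by
    rw [hQ, hR, Matrix.mul_assoc, ← Matrix.mul_assoc (mpow Y (1/2 : ℝ)), mpow_half_neg_mul hY,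
      Matrix.one_mul, mpow_neg_half_mul hX]
  have hRR : R * star R = mpow X (-(1/2 : ℝ)) * Y * mpow X (-(1/2 : ℝ)) := by
    rw [hR, StarMul.star_mul, star_mpow hX, star_mpow hY]
    calc _ = mpow X (-(1/2 : ℝ)) * (mpow Y (1/2 : ℝ) * mpow Y (1/2 : ℝ))
          * mpow X (-(1/2 : ℝ)) := by simp only [Matrix.mul_assoc]
      _ = _ := by rw [mpow_half_mul_self hY]
  have hconj : ∀ A : Mat m, Q * (mpow X (-(1/2 : ℝ)) * A * mpow X (-(1/2 : ℝ))) * star Q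
      = mpow Y (-(1/2 : ℝ)) * A * mpow Y (-(1/2 : ℝ)) := fun A => by
    rw [hQ, StarMul.star_mul, star_mpow hX, star_mpow hY]
    calc _ = mpow Y (-(1/2 : ℝ)) * (mpow X (1/2 : ℝ) * (mpow X (-(1/2 : ℝ)) * A
          * mpow X (-(1/2 : ℝ))) * mpow X (1/2 : ℝ)) * mpow Y (-(1/2 : ℝ)) := by
          simp only [Matrix.mul_assoc]
      _ = _ := by rw [mpow_half_conj_mpow_neg_half_conj hX]
  have iX := integrable_relLog hν hffm hX
  have iY := integrable_relLog hν hffm hY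
  rw [← hRR]
  refine norm_mul_star_sub_one_le hRQ (norm_nonneg _) hXν ?_
  refine le_trans ?_ ((le_abs_self _).trans
    (abs_re_trace_mul_le (R * star R - star Q * Q) (karcherLHS X ν)))
  have h1 : ∫ A, (reTraceMul (R * star R - star Q * Q) (relLog X A)
      - reTraceMul (star R * R - Q * star Q) (relLog Y A)) ∂ν
      = ((R * star R - star Q * Q) * karcherLHS X ν).trace.re := by
    rw [integral_sub ((reTraceMul _).integrable_comp iX) ((reTraceMul _).integrable_comp iY),
      (reTraceMul _).integral_comp_comm iX, (reTraceMul _).integral_comp_comm iY,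
      ← karcherLHS_eq, ← karcherLHS_eq, hYν, map_zero, sub_zero, reTraceMul_apply]
  rw [← h1]
  have h2 : ‖star R - Q‖ ^ 2 = ∫ _, ‖star R - Q‖ ^ 2 ∂ν := by simp
  rw [h2]
  refine integral_mono_ae (integrable_const _)
    (((reTraceMul _).integrable_comp iX).sub ((reTraceMul _).integrable_comp iY)) ?_
  filter_upwards [hν] with A hA
  have h3 := norm_star_inv_sub_sq_le (posDef_mpow_conj hX hA (-(1/2 : ℝ))) hRQ
  rwa [hconj] at h3

/-- Uniqueness of the positive definite solution of the Karcher equation. -/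
theorem eq_of_karcherLHS_eq_zero {ν : Measure (Mat m)} [IsProbabilityMeasure ν]
    (hν : ∀ᵐ A ∂ν, A.PosDef) (hffm : HasFFM ν) {X Y : Mat m} (hX : X.PosDef) (hY : Y.PosDef)
    (hXν : karcherLHS X ν = 0) (hYν : karcherLHS Y ν = 0) : X = Y := by
  have h := norm_conj_sub_one_le hν hffm hX hY hYν (by rw [hXν, norm_zero]; norm_num)
  rw [hXν, norm_zero, mul_zero, norm_le_zero_iff, sub_eq_zero] at h
  rw [← mpow_half_conj_mpow_neg_half_conj hX Y, h, Matrix.mul_one, mpow_half_mul_self hX]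

theorem eq_bary_iff {G : Measure (Mat m) → Mat m} (hG : IsCartanBary G) {ν : Measure (Mat m)}
    [hp : IsProbabilityMeasure ν] (hν : ∀ᵐ A ∂ν, A.PosDef) (hffm : HasFFM ν) {X : Mat m}
    (hX : X.PosDef) : X = G ν ↔ karcherLHS X ν = 0 := by
  obtain ⟨h1, h2⟩ := hG ν hp hν hffm
  exact ⟨fun h => h ▸ h2, fun h => eq_of_karcherLHS_eq_zero hν hffm hX h1 h h2⟩

open Filter Topology in
theorem tendsto_mpow_neg_half_mul_mpow_half {ι : Type*} {l : Filter ι} {β : ι → Mat m} {X : Mat m}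
    (hβ : ∀ t, (β t).PosDef) (hX : X.PosDef)
    (h : Tendsto (fun t => ‖mpow X (-(1/2 : ℝ)) * β t * mpow X (-(1/2 : ℝ)) - 1‖) l (𝓝 0)) :
    Tendsto (fun t => ‖mpow (β t) (-(1/2 : ℝ)) * mpow X (1/2 : ℝ) - 1‖) l (𝓝 0) := by
  have h1 : Tendsto β l (𝓝 X) := by
    rw [tendsto_iff_norm_sub_tendsto_zero]
    have h2 := (h.const_mul ‖mpow X (1/2 : ℝ)‖).mul_const ‖mpow X (1/2 : ℝ)‖
    rw [mul_zero, zero_mul] at h2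
    refine squeeze_zero (fun _ => norm_nonneg _) (fun t => ?_) h2
    have h3 : β t - X = mpow X (1/2 : ℝ) * (mpow X (-(1/2 : ℝ)) * β t * mpow X (-(1/2 : ℝ)) - 1)
        * mpow X (1/2 : ℝ) := by
      rw [Matrix.mul_sub, Matrix.sub_mul, mpow_half_conj_mpow_neg_half_conj hX, Matrix.mul_one,
        mpow_half_mul_self hX]
    rw [h3]
    refine (frobenius_norm_mul _ _).trans ?_
    gcongr
    exact frobenius_norm_mul _ _
  have h4 : Tendsto (fun t => mpow (β t) (-(1/2 : ℝ))) l (𝓝 (mpow X (-(1/2 : ℝ)))) :=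
    (continuousOn_mpow (-(1/2 : ℝ)) X hX).tendsto.comp
      (tendsto_nhdsWithin_iff.2 ⟨h1, Eventually.of_forall hβ⟩)
  rw [tendsto_iff_norm_sub_tendsto_zero] at h4
  have h5 := h4.mul_const ‖mpow X (1/2 : ℝ)‖
  rw [zero_mul] at h5
  refine squeeze_zero (fun _ => norm_nonneg _) (fun t => ?_) h5
  rw [← mpow_neg_half_mul hX, ← Matrix.sub_mul]
  exact frobenius_norm_mul _ _

theorem norm_star_sub_one (Q : Mat m) : ‖star Q - 1‖ = ‖Q - 1‖ := by
  have h : star Q - 1 = (Q - 1)ᴴ := by rw [conjTranspose_sub, conjTranspose_one]; rfl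
  rw [h, frobenius_norm_conjTranspose]

theorem norm_mul_mul_star_le (Q D : Mat m) : ‖Q * D * star Q‖ ≤ ‖Q‖ * ‖D‖ * ‖Q‖ := by
  have h : ‖star Q‖ = ‖Q‖ := frobenius_norm_conjTranspose Q
  refine (frobenius_norm_mul _ _).trans ?_
  rw [h]
  gcongr
  exact frobenius_norm_mul _ _

theorem norm_mul_mul_star_sub_le (Q D : Mat m) :
    ‖Q * D * star Q - D‖ ≤ ‖Q - 1‖ * ‖D‖ * (‖Q‖ + 1) := by
  have h : ‖star Q‖ = ‖Q‖ := frobenius_norm_conjTranspose Q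
  have h1 : Q * D * star Q - D = (Q - 1) * D * star Q + D * (star Q - 1) := by
    rw [Matrix.sub_mul, Matrix.sub_mul, Matrix.mul_sub, Matrix.one_mul, Matrix.mul_one]
    abel
  rw [h1]
  calc _ ≤ ‖Q - 1‖ * ‖D‖ * ‖star Q‖ + ‖D‖ * ‖star Q - 1‖ := by
        refine (norm_add_le _ _).trans (add_le_add ?_ (frobenius_norm_mul _ _))
        refine (frobenius_norm_mul _ _).trans ?_
        gcongr
        exact frobenius_norm_mul _ _
    _ = _ := by rw [h, norm_star_sub_one]; ring

open Filter Topology in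
theorem tendsto_inv_smul_relLog_geom {β : ℝ → Mat m} {X A : Mat m} (hβ : ∀ t, (β t).PosDef)
    (hX : X.PosDef) (hA : A.PosDef) {C : ℝ}
    (hC : ∀ᶠ t in 𝓝[≠] (0 : ℝ),
      ‖mpow X (-(1/2 : ℝ)) * β t * mpow X (-(1/2 : ℝ)) - 1‖ ≤ C * |t|) :
    Tendsto (fun t : ℝ => t⁻¹ • relLog (β t) (geom X t A)
      + t⁻¹ • (mpow X (-(1/2 : ℝ)) * β t * mpow X (-(1/2 : ℝ)) - 1)) (𝓝[≠] 0)
      (𝓝 (relLog X A)) := by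
  set B : ℝ → Mat m := fun t => mpow X (-(1/2 : ℝ)) * β t * mpow X (-(1/2 : ℝ)) with hB
  set M := mpow X (-(1/2 : ℝ)) * A * mpow X (-(1/2 : ℝ)) with hM
  set Q : ℝ → Mat m := fun t => mpow (β t) (-(1/2 : ℝ)) * mpow X (1/2 : ℝ) with hQ
  have hMpos : M.PosDef := posDef_mpow_conj hX hA _
  have ht0 : Tendsto (fun t : ℝ => |t|) (𝓝[≠] 0) (𝓝 0) := by
    have : Tendsto (fun t : ℝ => |t|) (𝓝 0) (𝓝 |0|) := continuous_abs.tendsto 0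
    rw [abs_zero] at this
    exact this.mono_left nhdsWithin_le_nhds
  have hB0 : Tendsto (fun t => ‖B t - 1‖) (𝓝[≠] 0) (𝓝 0) := by
    have := ht0.const_mul C
    rw [mul_zero] at this
    exact squeeze_zero' (Eventually.of_forall fun _ => norm_nonneg _) hC this
  have hQ0 : Tendsto (fun t => ‖Q t - 1‖) (𝓝[≠] 0) (𝓝 0) :=
    tendsto_mpow_neg_half_mul_mpow_half hβ hX hB0
  have hQ1 : Tendsto (fun t => ‖Q t‖) (𝓝[≠] 0) (𝓝 ‖(1 : Mat m)‖) :=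
    (tendsto_iff_norm_sub_tendsto_zero.2 hQ0).norm
  have hder : Tendsto (fun t : ℝ => ‖t⁻¹ • (mpow M t - 1) - mlog M‖) (𝓝[≠] 0) (𝓝 0) := by
    have h := hasDerivAt_iff_tendsto_slope_zero.1 (hasDerivAt_mpow_zero hMpos)
    simp only [zero_add, mpow_zero hMpos] at h
    exact tendsto_iff_norm_sub_tendsto_zero.1 h
  set D : ℝ → Mat m := fun t => t⁻¹ • (mpow M t - 1) - t⁻¹ • (B t - 1) with hD
  set c := ‖mlog M‖ + 1 + C with hc
  have hDc : ∀ᶠ t in 𝓝[≠] (0 : ℝ), ‖D t‖ ≤ c := by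
    filter_upwards [hC, hder.eventually_le_const one_pos, self_mem_nhdsWithin] with t h1 h2 h3
    have h3' : 0 < |t| := abs_pos.2 h3
    have h4 : ‖t⁻¹ • (B t - 1)‖ ≤ C := by
      rw [norm_smul, norm_inv, Real.norm_eq_abs, inv_mul_le_iff₀ h3', mul_comm]
      exact h1
    have h5 : ‖t⁻¹ • (mpow M t - 1)‖ ≤ 1 + ‖mlog M‖ := by
      have := norm_add_le (t⁻¹ • (mpow M t - 1) - mlog M) (mlog M)
      rw [sub_add_cancel] at this
      linarith
    have h6 := norm_sub_le (t⁻¹ • (mpow M t - 1)) (t⁻¹ • (B t - 1))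
    simp only [hD, hc]
    linarith
  have hN : ∀ t, mpow (β t) (-(1/2 : ℝ)) * geom X t A * mpow (β t) (-(1/2 : ℝ))
      = Q t * mpow M t * star (Q t) := fun t => by
    simp only [hQ, geom, StarMul.star_mul, star_mpow hX, star_mpow (hβ t), Matrix.mul_assoc]
    simp only [hM, Matrix.mul_assoc]
  have hQBQ : ∀ t, Q t * B t * star (Q t) = 1 := fun t => by
    calc Q t * B t * star (Q t) = mpow (β t) (-(1/2 : ℝ)) * (mpow X (1/2 : ℝ) *
          (mpow X (-(1/2 : ℝ)) * β t * mpow X (-(1/2 : ℝ))) * mpow X (1/2 : ℝ))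
          * mpow (β t) (-(1/2 : ℝ)) := by
          simp only [hQ, hB, StarMul.star_mul, star_mpow hX, star_mpow (hβ t), Matrix.mul_assoc]
      _ = 1 := by rw [mpow_half_conj_mpow_neg_half_conj hX, mpow_neg_half_conj_self (hβ t)]
  have hNE : ∀ t : ℝ, t ≠ 0 → Q t * mpow M t * star (Q t) - 1 = t • (Q t * D t * star (Q t)) := by
    intro t ht
    have h1 : t • D t = mpow M t - B t := by
      simp only [hD]
      rw [smul_sub, smul_inv_smul₀ ht, smul_inv_smul₀ ht]
      abel
    rw [← Matrix.smul_mul, ← Matrix.mul_smul, h1, Matrix.mul_sub, Matrix.sub_mul, hQBQ]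
  have hlim : Tendsto (fun t => 2 * |t| * (‖Q t‖ * c * ‖Q t‖) ^ 2
      + ‖Q t - 1‖ * c * (‖Q t‖ + 1) + ‖t⁻¹ • (mpow M t - 1) - mlog M‖) (𝓝[≠] 0) (𝓝 0) := by
    have h := (((ht0.const_mul 2).mul (((hQ1.mul_const c).mul hQ1).pow 2)).add
      ((hQ0.mul_const c).mul (hQ1.add_const 1))).add hder
    simpa using h
  have hsmall : ∀ᶠ t in 𝓝[≠] (0 : ℝ), |t| * (‖Q t‖ * c * ‖Q t‖) ≤ 1 / 2 := by
    have h := ht0.mul ((hQ1.mul_const c).mul hQ1)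
    rw [zero_mul] at h
    exact h.eventually_le_const (by norm_num)
  rw [tendsto_iff_norm_sub_tendsto_zero]
  refine squeeze_zero' (Eventually.of_forall fun _ => norm_nonneg _) ?_ hlim
  filter_upwards [hDc, hsmall, self_mem_nhdsWithin] with t h1 h2 h3
  have h3' : 0 < |t| := abs_pos.2 h3
  have hE : ‖Q t * D t * star (Q t)‖ ≤ ‖Q t‖ * c * ‖Q t‖ :=
    (norm_mul_mul_star_le _ _).trans (by gcongr)
  have hN1 : ‖Q t * mpow M t * star (Q t) - 1‖ ≤ |t| * (‖Q t‖ * c * ‖Q t‖) := by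
    rw [hNE t h3, norm_smul, Real.norm_eq_abs]
    gcongr
  have hNpos : (Q t * mpow M t * star (Q t)).PosDef := by
    rw [← hN]
    exact posDef_mpow_conj (hβ t) (posDef_geom hX hA t) _
  have hlog := norm_mlog_sub_le hNpos (hN1.trans h2)
  have hr : relLog (β t) (geom X t A) = mlog (Q t * mpow M t * star (Q t)) := by
    rw [relLog, hN]
  have hsplit : t⁻¹ • relLog (β t) (geom X t A) + t⁻¹ • (B t - 1) - relLog X A
      = t⁻¹ • (mlog (Q t * mpow M t * star (Q t)) - (Q t * mpow M t * star (Q t) - 1))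
        + (Q t * D t * star (Q t) - D t) + (t⁻¹ • (mpow M t - 1) - mlog M) := by
    have h4 : t⁻¹ • (Q t * mpow M t * star (Q t) - 1) = Q t * D t * star (Q t) := by
      rw [hNE t h3, inv_smul_smul₀ h3]
    rw [smul_sub t⁻¹ (mlog _), h4, hr]
    simp only [hD, relLog, ← hM]
    abel
  rw [hsplit]
  refine (norm_add₃_le).trans (add_le_add (add_le_add ?_ ?_) le_rfl)
  · rw [norm_smul, norm_inv, Real.norm_eq_abs, inv_mul_le_iff₀ h3']
    calc _ ≤ 2 * ‖Q t * mpow M t * star (Q t) - 1‖ ^ 2 := hlog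
      _ ≤ 2 * (|t| * (‖Q t‖ * c * ‖Q t‖)) ^ 2 := by gcongr
      _ = _ := by ring
  · refine (norm_mul_mul_star_sub_le _ _).trans ?_
    gcongr

open Filter Topology in
theorem tendsto_inv_smul_conj_bary_sub_one {G : Measure (Mat m) → Mat m} (hG : IsCartanBary G)
    {X : Mat m} (hX : X.PosDef) {μ : Measure (Mat m)} [IsProbabilityMeasure μ]
    (hμ : ∀ᵐ A ∂μ, A.PosDef) (hffm : HasFFM μ) (hmeas : ∀ t : ℝ, AEMeasurable (geom X t) μ) :
    Tendsto (fun t : ℝ => t⁻¹ • (mpow X (-(1/2 : ℝ)) * G (μ.map (geom X t))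
      * mpow X (-(1/2 : ℝ)) - 1)) (𝓝[≠] 0) (𝓝 (karcherLHS X μ)) := by
  set S := karcherLHS X μ with hS
  set β : ℝ → Mat m := fun t => G (μ.map (geom X t)) with hβdef
  have hprob : ∀ t, IsProbabilityMeasure (μ.map (geom X t)) := fun t =>
    Measure.isProbabilityMeasure_map (hmeas t)
  have hpos : ∀ t, ∀ᵐ A ∂(μ.map (geom X t)), A.PosDef := fun t =>
    ae_posDef_map_geom hX hμ (hmeas t)
  have hf : ∀ t, HasFFM (μ.map (geom X t)) := fun t => hasFFM_map_geom hX hμ hffm (hmeas t)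
  have hGt : ∀ t, (β t).PosDef ∧ karcherLHS (β t) (μ.map (geom X t)) = 0 := fun t =>
    hG _ (hprob t) (hpos t) (hf t)
  have hβ : ∀ t, (β t).PosDef := fun t => (hGt t).1
  have ht0 : Tendsto (fun t : ℝ => |t|) (𝓝[≠] 0) (𝓝 0) := by
    have : Tendsto (fun t : ℝ => |t|) (𝓝 0) (𝓝 |0|) := continuous_abs.tendsto 0
    rw [abs_zero] at this
    exact this.mono_left nhdsWithin_le_nhds
  have hC : ∀ᶠ t in 𝓝[≠] (0 : ℝ),
      ‖mpow X (-(1/2 : ℝ)) * β t * mpow X (-(1/2 : ℝ)) - 1‖ ≤ 5 * ‖S‖ * |t| := by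
    have h := ht0.mul_const ‖S‖
    rw [zero_mul] at h
    filter_upwards [h.eventually_le_const (by norm_num : (0 : ℝ) < 1 / 2)] with t ht
    have h1 : ‖karcherLHS X (μ.map (geom X t))‖ = |t| * ‖S‖ := by
      rw [karcherLHS_map_geom_self hX hμ (hmeas t), norm_smul, Real.norm_eq_abs]
    have h2 := norm_conj_sub_one_le (hpos t) (hf t) hX (hβ t) (hGt t).2 (h1.trans_le ht)
    rw [h1] at h2
    linarith
  have hSt : ∀ᶠ t in 𝓝[≠] (0 : ℝ), 5 * ‖S‖ * |t| ≤ 1 / 2 := by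
    have h := ht0.const_mul (5 * ‖S‖)
    rw [mul_zero] at h
    exact h.eventually_le_const (by norm_num)
  have hi : ∀ t, Integrable (fun A => relLog (β t) (geom X t A)) μ := fun t =>
    (integrable_map_measure (aestronglyMeasurable_of_continuousOn_posDef (hpos t)
      (continuousOn_relLog (hβ t))) (hmeas t)).1 (integrable_relLog (hpos t) (hf t) (hβ t))
  have hDCT := tendsto_integral_filter_of_dominated_convergence (μ := μ) (l := 𝓝[≠] (0 : ℝ))
    (F := fun t A => t⁻¹ • relLog (β t) (geom X t A)
      + t⁻¹ • (mpow X (-(1/2 : ℝ)) * β t * mpow X (-(1/2 : ℝ)) - 1)) (f := relLog X)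
    (fun A => √m * (2 * (5 * ‖S‖) + ‖relLog X A‖) + 5 * ‖S‖)
    (Eventually.of_forall fun t => ((hi t).smul t⁻¹).aestronglyMeasurable.add
      aestronglyMeasurable_const)
    (by
      filter_upwards [hC, hSt, self_mem_nhdsWithin] with t h1 h2 h3
      have h3' : 0 < |t| := abs_pos.2 h3
      filter_upwards [hμ] with A hA
      refine (norm_add_le _ _).trans (add_le_add ?_ ?_)
      · rw [norm_smul, norm_inv, Real.norm_eq_abs, inv_mul_le_iff₀ h3']
        have h4 : ‖relLog X (β t)‖ ≤ 2 * (5 * ‖S‖ * |t|) :=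
          (norm_mlog_le_two_mul (posDef_mpow_conj hX (hβ t) _) (h1.trans h2)).trans (by gcongr)
        calc _ ≤ √m * (‖relLog X (β t)‖ + ‖relLog X (geom X t A)‖) :=
              norm_relLog_triangle hX (hβ t) (posDef_geom hX hA t)
          _ ≤ √m * (2 * (5 * ‖S‖ * |t|) + |t| * ‖relLog X A‖) := by
              rw [relLog_geom hX hA, norm_smul, Real.norm_eq_abs]
              gcongr
          _ = _ := by ring
      · rw [norm_smul, norm_inv, Real.norm_eq_abs, inv_mul_le_iff₀ h3', mul_comm]
        exact h1)
    ((((integrable_const _).add (integrable_relLog hμ hffm hX).norm).const_mul _).add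
      (integrable_const _))
    (by filter_upwards [hμ] with A hA using tendsto_inv_smul_relLog_geom hβ hX hA hC)
  rw [← karcherLHS_eq, ← hS] at hDCT
  refine hDCT.congr fun t => ?_
  have hi' : Integrable (fun A => t⁻¹ • relLog (β t) (geom X t A)) μ := (hi t).smul t⁻¹
  rw [integral_add hi' (integrable_const _), integral_smul,
    ← karcherLHS_map_geom hX hμ (hmeas t) (hβ t), (hGt t).2, smul_zero, zero_add, integral_const,
    probReal_univ, one_smul]

end FrobeniusTopology

open Filter Topology in
/-- The derivative of the barycentric trajectory at the origin. -/
theorem hasDerivAt_bary {G : Measure (Mat m) → Mat m} (hG : IsCartanBary G)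
    {X : Mat m} (hX : X.PosDef) {μ : Measure (Mat m)} [IsProbabilityMeasure μ]
    (hμ : ∀ᵐ A ∂μ, A.PosDef) (hffm : HasFFM μ) (hmeas : ∀ t : ℝ, AEMeasurable (geom X t) μ) :
    HasDerivAt (fun t : ℝ => G (μ.map (geom X t)))
      (mpow X (1/2 : ℝ) * karcherLHS X μ * mpow X (1/2 : ℝ)) 0 := by
  have hprob := Measure.isProbabilityMeasure_map (hmeas 0)
  have h0 : G (μ.map (geom X 0)) = X := by
    refine ((eq_bary_iff hG (ae_posDef_map_geom hX hμ (hmeas 0))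
      (hasFFM_map_geom hX hμ hffm (hmeas 0)) hX).2 ?_).symm
    rw [karcherLHS_map_geom_self hX hμ (hmeas 0), zero_smul]
  have hcont : Continuous fun D : Mat m => mpow X (1/2 : ℝ) * D * mpow X (1/2 : ℝ) := by fun_prop
  have h := (hcont.tendsto _).comp (tendsto_inv_smul_conj_bary_sub_one hG hX hμ hffm hmeas)
  refine hasDerivAt_iff_tendsto_slope_zero.2 (h.congr fun t => ?_)
  rw [Function.comp_apply, zero_add, h0, Matrix.mul_smul, Matrix.smul_mul, Matrix.mul_sub,
    Matrix.sub_mul, mpow_half_conj_mpow_neg_half_conj hX, Matrix.mul_one, mpow_half_mul_self hX]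

end Karcher

/-- For `β(t) = G(X #_t μ)`, the following are equivalent: (i) `β'(0) = 0`;
(ii) `X = G(μ)`; (iii) `X = G(X #_t μ)` for all (equivalently some) `t ≠ 0`. -/
theorem stmt18 {m : ℕ} (G : Measure (Mat m) → Mat m) (hG : IsCartanBary G)
    (X : Mat m) (hX : X.PosDef) (μ : Measure (Mat m)) (hμ : IsProbabilityMeasure μ)
    (hμpos : ∀ᵐ A ∂μ, A.PosDef) (hμffm : HasFFM μ)
    (hmeas : ∀ t : ℝ, AEMeasurable (geom X t) μ) :
    (deriv (fun t : ℝ => G (μ.map (geom X t))) 0 = 0 ↔ X = G μ) ∧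
    (X = G μ ↔ ∀ t : ℝ, t ≠ 0 → X = G (μ.map (geom X t))) ∧
    (X = G μ ↔ ∃ t : ℝ, t ≠ 0 ∧ X = G (μ.map (geom X t))) := by
  have hXt : ∀ t : ℝ, t ≠ 0 → (X = G (μ.map (geom X t)) ↔ karcherLHS X μ = 0) := fun t ht => by
    have := Measure.isProbabilityMeasure_map (hmeas t)
    rw [eq_bary_iff hG (ae_posDef_map_geom hX hμpos (hmeas t))
      (hasFFM_map_geom hX hμpos hμffm (hmeas t)) hX, karcherLHS_map_geom_self hX hμpos (hmeas t),
      smul_eq_zero_iff_right ht]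
  have hd : deriv (fun t : ℝ => G (μ.map (geom X t))) 0
      = mpow X (1/2 : ℝ) * karcherLHS X μ * mpow X (1/2 : ℝ) :=
    (hasDerivAt_bary hG hX hμpos hμffm hmeas).deriv
  rw [hd, eq_bary_iff hG hμpos hμffm hX]
  refine ⟨⟨fun h => ?_, fun h => ?_⟩, ⟨fun h t ht => (hXt t ht).2 h, fun h => ?_⟩,
    ⟨fun h => ⟨1, one_ne_zero, (hXt 1 one_ne_zero).2 h⟩, fun ⟨t, ht, h⟩ => (hXt t ht).1 h⟩⟩
  · rw [← mpow_neg_half_conj_mpow_half_conj hX (karcherLHS X μ), h, Matrix.mul_zero,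
      Matrix.zero_mul]
  · rw [h, Matrix.mul_zero, Matrix.zero_mul]
  · exact (hXt 1 one_ne_zero).1 (h 1 one_ne_zero)
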